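/- arXiv:1603.00311 — 2 statements merged into one kernel-verified Lean document; each statement's English description precedes it below -/
import Mathlib

section
/- Let n ≥ 1, p ∈ (0,1), δ ∈ (0,1), and let ξ^{(1)},…,ξ^{(N)} be i.i.d. random vectors, each uniformly distributed on the closed unit Euclidean ball B^n ⊂ ℝ^n, with empirical maximum η = max_{1≤i≤N} ξ₁^{(i)}. Then P{η > 1−δ} ≥ p if and only if N ≥ ln(1−p) / ln[1/2 + (1/2) I((1−δ)²; 1/2, (n+1)/2)]; in particular, the minimal sample size guaranteeing P{η > 1−δ} ≥ p is N_min = ⌈ln(1−p) / ln(1/2 + (1/2) I((1−δ)²; 1/2, (n+1)/2))⌉. -/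
open MeasureTheory

/-- The uniform probability measure on the closed unit Euclidean ball in `ℝⁿ`. -/
noncomputable def unifBall (n : ℕ) : Measure (Fin n → ℝ) :=
  (volume {x : Fin n → ℝ | ∑ i, (x i) ^ 2 ≤ 1})⁻¹ •
    volume.restrict {x : Fin n → ℝ | ∑ i, (x i) ^ 2 ≤ 1}

/-- The regularized incomplete beta function
`I(x; a, b) = (1 / B(a,b)) ∫₀ˣ t^(a-1) (1-t)^(b-1) dt`, `B(a,b) = Γ(a)Γ(b)/Γ(a+b)`. -/
noncomputable def regIncBeta (x a b : ℝ) : ℝ :=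
  (Real.Gamma (a + b) / (Real.Gamma a * Real.Gamma b)) *
    ∫ t in (0 : ℝ)..x, t ^ (a - 1) * (1 - t) ^ (b - 1)

/-- The density, up to normalization, of the first coordinate of a uniform point of the unit ball
of `ℝ^(m+1)`: the factor by which the slice at height `t` scales the unit ball of `ℝᵐ`. -/
noncomputable def ballSliceWeight (m : ℕ) (t : ℝ) : ℝ := √(1 - t ^ 2) ^ m

lemma continuous_ballSliceWeight (m : ℕ) : Continuous (ballSliceWeight m) := by
  unfold ballSliceWeight
  fun_prop

lemma ballSliceWeight_nonneg (m : ℕ) (t : ℝ) : 0 ≤ ballSliceWeight m t :=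
  pow_nonneg (Real.sqrt_nonneg _) _

lemma ballSliceWeight_pos (m : ℕ) {t : ℝ} (ht : t ∈ Set.Ioo (-1 : ℝ) 1) :
    0 < ballSliceWeight m t := by
  refine pow_pos (Real.sqrt_pos.2 ?_) _
  nlinarith [ht.1, ht.2]

lemma integral_ballSliceWeight_pos (m : ℕ) {a b : ℝ} (ha : -1 ≤ a) (hab : a < b) (hb : b ≤ 1) :
    0 < ∫ t in a..b, ballSliceWeight m t :=
  intervalIntegral.intervalIntegral_pos_of_pos_on
    ((continuous_ballSliceWeight m).intervalIntegrable _ _)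
    (fun _ ht => ballSliceWeight_pos m ⟨ha.trans_lt ht.1, ht.2.trans_le hb⟩) hab

lemma integral_ballSliceWeight_neg_zero (m : ℕ) (a : ℝ) :
    ∫ t in (-a)..0, ballSliceWeight m t = ∫ t in (0 : ℝ)..a, ballSliceWeight m t := by
  have h := intervalIntegral.integral_comp_neg (a := 0) (b := a) (ballSliceWeight m)
  simp only [neg_zero] at h
  rw [← h]
  simp [ballSliceWeight]

lemma integral_beta_kernel_eq (m : ℕ) {s : ℝ} (hs0 : 0 ≤ s) (hs1 : s ≤ 1) :
    ∫ u in (0 : ℝ)..s ^ 2, u ^ ((1 / 2 : ℝ) - 1) * (1 - u) ^ ((((m + 1 : ℕ) : ℝ) + 1) / 2 - 1) =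
      2 * ∫ t in (0 : ℝ)..s, ballSliceWeight m t := by
  have hm : ((((m + 1 : ℕ) : ℝ) + 1) / 2 - 1) = m / 2 := by push_cast; ring
  rw [hm]
  have hm0 : (0 : ℝ) ≤ m / 2 := by positivity
  set g : ℝ → ℝ := fun u => u ^ ((1 / 2 : ℝ) - 1) * (1 - u) ^ ((m : ℝ) / 2) with hg
  have key : ∀ t ∈ Set.uIoc 0 s, (g ∘ fun t => t ^ 2) t * (2 * t) = 2 * ballSliceWeight m t := by
    intro t ht
    rw [Set.uIoc_of_le hs0] at ht
    have h1 : 0 ≤ 1 - t ^ 2 := by nlinarith [ht.1, ht.2]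
    have h2 : (t ^ 2) ^ ((1 / 2 : ℝ) - 1) = t⁻¹ := by
      rw [← Real.rpow_natCast, ← Real.rpow_mul ht.1.le, ← Real.rpow_neg_one]
      norm_num
    have h3 : (1 - t ^ 2) ^ ((m : ℝ) / 2) = √(1 - t ^ 2) ^ m := by
      rw [Real.sqrt_eq_rpow, ← Real.rpow_natCast _ m, ← Real.rpow_mul h1]
      ring_nf
    simp only [hg, Function.comp, h2, h3, ballSliceWeight]
    field_simp [ht.1.ne']
  have sub := intervalIntegral.integral_comp_mul_deriv''' (a := 0) (b := s)
    (f := fun t => t ^ 2) (f' := fun t => 2 * t) (g := g) (by fun_prop)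
    (fun x _ => by simpa using (hasDerivAt_pow 2 x).hasDerivWithinAt)
    ?_ ?_ ?_
  · simp only [ne_eq, OfNat.ofNat_ne_zero, not_false_eq_true, zero_pow] at sub
    rw [← sub, ← intervalIntegral.integral_const_mul]
    exact intervalIntegral.integral_congr_ae (Filter.Eventually.of_forall key)
  · rintro _ ⟨t, ht, rfl⟩
    rw [min_eq_left hs0, max_eq_right hs0] at ht
    have : t ^ 2 ≠ 0 := pow_ne_zero _ ht.1.ne'
    exact ((Real.continuousAt_rpow_const _ _ (Or.inl this)).mul
      (((continuous_const.sub continuous_id).rpow_const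
        (fun _ => Or.inr hm0)).continuousAt)).continuousWithinAt
  · have hi : IntervalIntegrable g volume 0 1 :=
      (intervalIntegral.intervalIntegrable_rpow' (by norm_num)).mul_continuousOn
        ((continuous_const.sub continuous_id).rpow_const (fun _ => Or.inr hm0)).continuousOn
    rw [intervalIntegrable_iff_integrableOn_Icc_of_le zero_le_one] at hi
    refine hi.mono_set ?_
    rintro _ ⟨t, ht, rfl⟩
    rw [Set.uIcc_of_le hs0] at ht
    exact ⟨sq_nonneg t, pow_le_one₀ ht.1 (ht.2.trans hs1)⟩
  · rw [Set.uIcc_of_le hs0, ← intervalIntegrable_iff_integrableOn_Icc_of_le hs0]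
    exact (((continuous_ballSliceWeight m).const_mul 2).intervalIntegrable 0 s).congr
      (fun t ht => (key t ht).symm)

lemma integral_beta_kernel_zero_one {a b : ℝ} (ha : 0 < a) (hb : 0 < b) :
    ∫ t in (0 : ℝ)..1, t ^ (a - 1) * (1 - t) ^ (b - 1) =
      Real.Gamma a * Real.Gamma b / Real.Gamma (a + b) := by
  have h := ProbabilityTheory.beta_eq_betaIntegralReal a b ha hb
  rw [ProbabilityTheory.beta] at h
  rw [h, Complex.betaIntegral]
  rw [← Complex.ofReal_re (∫ t in (0 : ℝ)..1, t ^ (a - 1) * (1 - t) ^ (b - 1)),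
    ← intervalIntegral.integral_ofReal]
  congr 1
  refine intervalIntegral.integral_congr fun t ht => ?_
  rw [Set.uIcc_of_le zero_le_one] at ht
  have h1 : (0 : ℝ) ≤ 1 - t := sub_nonneg.2 ht.2
  simp only [Complex.ofReal_mul, Complex.ofReal_cpow ht.1, Complex.ofReal_cpow h1]
  push_cast
  rfl

lemma regIncBeta_sq_eq (m : ℕ) {s : ℝ} (hs0 : 0 ≤ s) (hs1 : s ≤ 1) :
    regIncBeta (s ^ 2) (1 / 2) ((((m + 1 : ℕ) : ℝ) + 1) / 2) =
      (∫ t in (0 : ℝ)..s, ballSliceWeight m t) / ∫ t in (0 : ℝ)..1, ballSliceWeight m t := by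
  have hb : (0 : ℝ) < (((m + 1 : ℕ) : ℝ) + 1) / 2 := by positivity
  have h1 := integral_beta_kernel_eq m zero_le_one le_rfl
  rw [one_pow, integral_beta_kernel_zero_one one_half_pos hb] at h1
  rw [regIncBeta, integral_beta_kernel_eq m hs0 hs1, ← inv_div, h1]
  have := integral_ballSliceWeight_pos m (by norm_num) zero_lt_one le_rfl
  field_simp

lemma half_add_half_regIncBeta (m : ℕ) {s : ℝ} (hs0 : 0 ≤ s) (hs1 : s ≤ 1) :
    1 / 2 + 1 / 2 * regIncBeta (s ^ 2) (1 / 2) ((((m + 1 : ℕ) : ℝ) + 1) / 2) =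
      (∫ t in (-1 : ℝ)..s, ballSliceWeight m t) / ∫ t in (-1 : ℝ)..1, ballSliceWeight m t := by
  have hi : ∀ a b, IntervalIntegrable (ballSliceWeight m) volume a b :=
    (continuous_ballSliceWeight m).intervalIntegrable
  rw [regIncBeta_sq_eq m hs0 hs1,
    ← intervalIntegral.integral_add_adjacent_intervals (hi (-1) 0) (hi 0 s),
    ← intervalIntegral.integral_add_adjacent_intervals (hi (-1) 0) (hi 0 1),
    integral_ballSliceWeight_neg_zero]
  have := integral_ballSliceWeight_pos m (by norm_num) zero_lt_one le_rfl
  field_simp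
  ring

lemma volume_sum_sq_le_one_ne_zero (m : ℕ) :
    volume {y : Fin m → ℝ | ∑ i, y i ^ 2 ≤ 1} ≠ 0 := by
  have ho : IsOpen {y : Fin m → ℝ | ∑ i, y i ^ 2 < 1} :=
    isOpen_lt (by fun_prop) continuous_const
  have hpos := ho.measure_pos volume ⟨0, by simp⟩
  exact (hpos.trans_le (measure_mono fun y hy => le_of_lt (Set.mem_ofPred_eq ▸ hy))).ne'

lemma volume_sum_sq_le_one_ne_top (m : ℕ) :
    volume {y : Fin m → ℝ | ∑ i, y i ^ 2 ≤ 1} ≠ ⊤ := by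
  refine ((measure_mono ?_).trans_lt
    (isCompact_Icc (a := fun _ : Fin m => (-1 : ℝ)) (b := fun _ => 1)).measure_lt_top).ne
  intro y hy
  rw [Set.mem_ofPred_eq] at hy
  have h : ∀ i, |y i| ≤ 1 := fun i => by
    rw [← sq_le_one_iff_abs_le_one]
    exact (Finset.single_le_sum (f := fun i => y i ^ 2) (fun _ _ => sq_nonneg _)
      (Finset.mem_univ i)).trans hy
  exact ⟨fun i => (abs_le.1 (h i)).1, fun i => (abs_le.1 (h i)).2⟩

lemma volume_sum_sq_le_sq (m : ℕ) {r : ℝ} (hr : 0 < r) :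
    volume {y : Fin m → ℝ | ∑ i, y i ^ 2 ≤ r ^ 2} =
      ENNReal.ofReal (r ^ m) * volume {y : Fin m → ℝ | ∑ i, y i ^ 2 ≤ 1} := by
  have h := Measure.addHaar_smul (volume : Measure (Fin m → ℝ)) r {y | ∑ i, y i ^ 2 ≤ 1}
  rw [Module.finrank_fin_fun, abs_of_pos (pow_pos hr m)] at h
  rw [← h]
  congr 1
  ext y
  rw [Set.mem_smul_set_iff_inv_smul_mem₀ hr.ne']
  simp only [Set.mem_ofPred_eq, Pi.smul_apply, smul_eq_mul, mul_pow, ← Finset.mul_sum]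
  rw [inv_pow, inv_mul_le_one₀ (by positivity)]

/-- Slicing the unit ball of `ℝ^(m+1)` orthogonally to its first axis. -/
lemma volume_ball_inter_head_mem (m : ℕ) {A : Set ℝ} (hA : MeasurableSet A) :
    volume ({x : Fin (m + 1) → ℝ | ∑ i, x i ^ 2 ≤ 1} ∩ {x | x 0 ∈ A}) =
      (∫⁻ t in A ∩ Set.Ioc (-1) 1, ENNReal.ofReal (ballSliceWeight m t)) *
        volume {y : Fin m → ℝ | ∑ i, y i ^ 2 ≤ 1} := by
  have hS : MeasurableSet {z : ℝ × (Fin m → ℝ) | z.1 ^ 2 + ∑ i, z.2 i ^ 2 ≤ 1 ∧ z.1 ∈ A} :=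
    (measurableSet_le (f := fun z : ℝ × (Fin m → ℝ) => z.1 ^ 2 + ∑ i, z.2 i ^ 2)
      (by fun_prop) measurable_const).inter (measurable_fst hA)
  have e := volume_preserving_piFinSuccAbove (fun _ : Fin (m + 1) => ℝ) 0
  have hpre : {x : Fin (m + 1) → ℝ | ∑ i, x i ^ 2 ≤ 1} ∩ {x | x 0 ∈ A} =
      MeasurableEquiv.piFinSuccAbove (fun _ : Fin (m + 1) => ℝ) 0 ⁻¹'
        {z : ℝ × (Fin m → ℝ) | z.1 ^ 2 + ∑ i, z.2 i ^ 2 ≤ 1 ∧ z.1 ∈ A} := by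
    ext x
    simp [Fin.sum_univ_succ, Fin.tail]
  rw [hpre, e.measure_preimage hS.nullMeasurableSet, Measure.volume_eq_prod,
    Measure.prod_apply hS, ← lintegral_mul_const _
      (continuous_ballSliceWeight m).measurable.ennreal_ofReal,
    ← lintegral_indicator (hA.inter measurableSet_Ioc)]
  refine lintegral_congr_ae ?_
  filter_upwards [Measure.ae_ne volume (-1 : ℝ), Measure.ae_ne volume (1 : ℝ)] with t ht ht'
  by_cases hmem : t ∈ A ∩ Set.Ioc (-1) 1
  · have hpos : 0 < 1 - t ^ 2 := by
      nlinarith [hmem.2.1, lt_of_le_of_ne hmem.2.2 ht']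
    rw [Set.indicator_of_mem hmem, ballSliceWeight,
      ← volume_sum_sq_le_sq m (Real.sqrt_pos.2 hpos), Real.sq_sqrt hpos.le]
    congr 1
    ext y
    simp [hmem.1, le_sub_iff_add_le']
  · rw [Set.indicator_of_notMem hmem]
    convert measure_empty (μ := (volume : Measure (Fin m → ℝ)))
    refine Set.eq_empty_of_forall_notMem fun y ⟨hy, htA⟩ => hmem ⟨htA, ?_⟩
    have hy' : 0 ≤ ∑ i, y i ^ 2 := Finset.sum_nonneg fun _ _ => sq_nonneg _
    have habs : |t| ≤ 1 := (sq_le_one_iff_abs_le_one t).1 (by simp only at hy; linarith)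
    exact ⟨lt_of_le_of_ne (abs_le.1 habs).1 ht.symm, (abs_le.1 habs).2⟩

lemma lintegral_ballSliceWeight_Ioc (m : ℕ) {a b : ℝ} (hab : a ≤ b) :
    ∫⁻ t in Set.Ioc a b, ENNReal.ofReal (ballSliceWeight m t) =
      ENNReal.ofReal (∫ t in a..b, ballSliceWeight m t) := by
  rw [intervalIntegral.integral_of_le hab, ofReal_integral_eq_lintegral_ofReal
    ((continuous_ballSliceWeight m).integrableOn_Ioc)
    (Filter.Eventually.of_forall (ballSliceWeight_nonneg m))]

lemma isProbabilityMeasure_unifBall (n : ℕ) : IsProbabilityMeasure (unifBall n) where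
  measure_univ := by
    simp [unifBall, ENNReal.inv_mul_cancel (volume_sum_sq_le_one_ne_zero n)
      (volume_sum_sq_le_one_ne_top n)]

lemma unifBall_head_le (m : ℕ) {s : ℝ} (hs0 : 0 ≤ s) (hs1 : s ≤ 1) :
    unifBall (m + 1) {x | x 0 ≤ s} = ENNReal.ofReal
      (1 / 2 + 1 / 2 * regIncBeta (s ^ 2) (1 / 2) ((((m + 1 : ℕ) : ℝ) + 1) / 2)) := by
  have hmeas : MeasurableSet {x : Fin (m + 1) → ℝ | x 0 ≤ s} :=
    measurableSet_le (measurable_pi_apply 0) measurable_const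
  have htot := volume_ball_inter_head_mem m MeasurableSet.univ
  have hle := volume_ball_inter_head_mem m (measurableSet_Iic (a := s))
  have hI : Set.Iic s ∩ Set.Ioc (-1) 1 = Set.Ioc (-1) s := by
    ext t
    simp only [Set.mem_inter_iff, Set.mem_Iic, Set.mem_Ioc]
    exact ⟨fun h => ⟨h.2.1, h.1⟩, fun h => ⟨h.2, h.1, h.2.trans hs1⟩⟩
  rw [hI, lintegral_ballSliceWeight_Ioc m (by linarith)] at hle
  simp only [Set.mem_univ, Set.ofPred_true, Set.inter_univ, Set.univ_inter] at htot
  rw [lintegral_ballSliceWeight_Ioc m (by norm_num)] at htot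
  have hpos := integral_ballSliceWeight_pos m le_rfl (show (-1 : ℝ) < 1 by norm_num) le_rfl
  rw [unifBall, Measure.smul_apply, Measure.restrict_apply hmeas, Set.inter_comm, smul_eq_mul,
    half_add_half_regIncBeta m hs0 hs1, ENNReal.ofReal_div_of_pos hpos, htot]
  simp only [Set.mem_Iic] at hle
  rw [hle, mul_comm, ← div_eq_mul_inv, ENNReal.mul_div_mul_right _ _
    (volume_sum_sq_le_one_ne_zero m) (volume_sum_sq_le_one_ne_top m)]

lemma half_add_half_regIncBeta_mem_Ioo (m : ℕ) {s : ℝ} (hs0 : 0 ≤ s) (hs1 : s < 1) :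
    1 / 2 + 1 / 2 * regIncBeta (s ^ 2) (1 / 2) ((((m + 1 : ℕ) : ℝ) + 1) / 2) ∈
      Set.Ioo (0 : ℝ) 1 := by
  have hi : ∀ a b, IntervalIntegrable (ballSliceWeight m) volume a b :=
    (continuous_ballSliceWeight m).intervalIntegrable
  have h1 := integral_ballSliceWeight_pos m le_rfl (show -1 < s by linarith) hs1.le
  have h2 := integral_ballSliceWeight_pos m (show -1 ≤ s by linarith) hs1 le_rfl
  rw [half_add_half_regIncBeta m hs0 hs1.le,
    ← intervalIntegral.integral_add_adjacent_intervals (hi (-1) s) (hi s 1)]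
  exact ⟨by positivity, (div_lt_one (by positivity)).2 (by linarith)⟩

/-- The law of the maximum of `N` independent copies of a real random variable `f`; the junk value
`0` of the supremum over no sample is harmless as long as the threshold is nonnegative. -/
lemma measure_pi_lt_iSup {α : Type*} [MeasurableSpace α] (μ : Measure α) [IsProbabilityMeasure μ]
    {f : α → ℝ} (hf : Measurable f) {s : ℝ} (hs : 0 ≤ s) (N : ℕ) :
    Measure.pi (fun _ : Fin N => μ) {ξ | s < ⨆ i, f (ξ i)} = 1 - μ {x | f x ≤ s} ^ N := by
  have hcompl : {ξ : Fin N → α | s < ⨆ i, f (ξ i)} =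
      (Set.univ.pi fun _ : Fin N => {x | f x ≤ s})ᶜ := by
    ext ξ
    rw [Set.mem_compl_iff, Set.mem_ofPred_eq, ← not_le, not_iff_not]
    simp only [Set.mem_pi, Set.mem_univ, true_implies, Set.mem_ofPred_eq]
    exact ⟨fun h i => (le_ciSup (f := fun i => f (ξ i)) (Set.finite_range _).bddAbove i).trans h,
      fun h => Real.iSup_le h hs⟩
  rw [hcompl, prob_compl_eq_one_sub
    (MeasurableSet.univ_pi fun _ => measurableSet_le hf measurable_const), Measure.pi_pi]
  simp

lemma ofReal_le_one_sub_ofReal_pow_iff {p q : ℝ} (hp : p ∈ Set.Ioo (0 : ℝ) 1)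
    (hq : q ∈ Set.Ioo (0 : ℝ) 1) (N : ℕ) :
    ENNReal.ofReal p ≤ 1 - ENNReal.ofReal q ^ N ↔ Real.log (1 - p) / Real.log q ≤ N := by
  have hqN : 0 < q ^ N := pow_pos hq.1 N
  have hlog : Real.log q < 0 := Real.log_neg hq.1 hq.2
  rw [← ENNReal.ofReal_pow hq.1.le, ← ENNReal.ofReal_one, ← ENNReal.ofReal_sub _ hqN.le,
    ENNReal.ofReal_le_ofReal_iff (sub_nonneg.2 (pow_le_one₀ hq.1.le hq.2.le)),
    div_le_iff_of_neg hlog, ← Real.log_pow, Real.log_le_log_iff hqN (sub_pos.2 hp.2)]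
  constructor <;> intro h <;> linarith

/-- Theorem 1 (ball, scalar optimization): for `N` i.i.d. samples uniform on the unit
Euclidean ball in `ℝⁿ` with empirical maximum `η = maxᵢ ξ₁⁽ⁱ⁾`, one has `P{η > 1-δ} ≥ p`
iff `N ≥ ln(1-p) / ln(1/2 + (1/2) I((1-δ)²; 1/2, (n+1)/2))`; in particular the minimal such
sample size is the ceiling of that ratio. -/
theorem stmt_4 (n : ℕ) (hn : 1 ≤ n) (p δ : ℝ)
    (hp : p ∈ Set.Ioo (0 : ℝ) 1) (hδ : δ ∈ Set.Ioo (0 : ℝ) 1) :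
    (∀ N : ℕ,
      ENNReal.ofReal p ≤
          Measure.pi (fun _ : Fin N => unifBall n)
            {ξ : Fin N → Fin n → ℝ | 1 - δ < ⨆ i : Fin N, ξ i ⟨0, hn⟩} ↔
        Real.log (1 - p) /
            Real.log (1 / 2 + 1 / 2 * regIncBeta ((1 - δ) ^ 2) (1 / 2) (((n : ℝ) + 1) / 2)) ≤
          (N : ℝ)) ∧
    IsLeast
      {N : ℕ |
        ENNReal.ofReal p ≤
          Measure.pi (fun _ : Fin N => unifBall n)
            {ξ : Fin N → Fin n → ℝ | 1 - δ < ⨆ i : Fin N, ξ i ⟨0, hn⟩}}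
      ⌈Real.log (1 - p) /
          Real.log (1 / 2 + 1 / 2 * regIncBeta ((1 - δ) ^ 2) (1 / 2) (((n : ℝ) + 1) / 2))⌉₊ := by
  obtain ⟨m, rfl⟩ : ∃ m, n = m + 1 := ⟨n - 1, by omega⟩
  have := isProbabilityMeasure_unifBall (m + 1)
  have hs0 : 0 ≤ 1 - δ := sub_nonneg.2 hδ.2.le
  have hs1 : 1 - δ < 1 := sub_lt_self _ hδ.1
  have main (N : ℕ) := by
    have h := ofReal_le_one_sub_ofReal_pow_iff hp (half_add_half_regIncBeta_mem_Ioo m hs0 hs1) N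
    rwa [← unifBall_head_le m hs0 hs1.le,
      ← measure_pi_lt_iSup (unifBall (m + 1)) (measurable_pi_apply 0) hs0 N] at h
  exact ⟨main, (main _).2 (Nat.le_ceil _), fun N hN => Nat.ceil_le.2 ((main N).1 hN)⟩
end

section
/- Let n ≥ 2, p ∈ (0,1), δ ∈ (0,1), let c₁, c₂ ∈ ℝ^n be orthonormal vectors, and let ξ^{(1)},…,ξ^{(N)} be i.i.d. random vectors, each uniformly distributed on the closed unit Euclidean ball B^n ⊂ ℝ^n. With κ = max_{1≤i≤N} ‖(c₁ᵀξ^{(i)}, c₂ᵀξ^{(i)})‖₂, one has P{κ > 1−δ} ≥ p if and only if N ≥ ln(1−p) / ln(1 − (2δ − δ²)^{n/2}); i.e., the minimal sample size guaranteeing that at least one sample is mapped at least δ-close to the boundary of the image disk with probability at least p is N_min = ⌈ln(1−p) / ln(1 − (2δ − δ²)^{n/2})⌉. -/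
open MeasureTheory Matrix

lemma volume_disk_le (b : ℝ) :
    volume {u : Fin 2 → ℝ | u 0 ^ 2 + u 1 ^ 2 ≤ b} = ENNReal.ofReal (Real.pi * b) := by
  rcases lt_or_ge b 0 with hb | hb
  · have : {u : Fin 2 → ℝ | u 0 ^ 2 + u 1 ^ 2 ≤ b} = ∅ := by
      ext u
      simp only [Set.mem_ofPred_eq, Set.mem_empty_iff_false, iff_false, not_le]
      nlinarith [sq_nonneg (u 0), sq_nonneg (u 1)]
    rw [this, measure_empty, ENNReal.ofReal_of_nonpos]
    nlinarith [Real.pi_pos]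
  · have h := (EuclideanSpace.volume_preserving_symm_measurableEquiv_toLp
      (Fin 2)).symm.measure_preimage_equiv
      (Metric.closedBall (0 : EuclideanSpace ℝ (Fin 2)) (Real.sqrt b))
    rw [EuclideanSpace.volume_closedBall_fin_two] at h
    have hs : {u : Fin 2 → ℝ | u 0 ^ 2 + u 1 ^ 2 ≤ b} =
        (MeasurableEquiv.toLp 2 (Fin 2 → ℝ)).symm.symm ⁻¹'
          (Metric.closedBall (0 : EuclideanSpace ℝ (Fin 2)) (Real.sqrt b)) := by
      ext u
      simp [EuclideanSpace.norm_eq, Real.sqrt_le_sqrt_iff hb]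
    rw [hs, h, ← ENNReal.ofReal_pow (Real.sqrt_nonneg b), Real.sq_sqrt hb, mul_comm Real.pi,
      ENNReal.ofReal_mul hb]

lemma measurableSet_disk_le (b : ℝ) :
    MeasurableSet {u : Fin 2 → ℝ | u 0 ^ 2 + u 1 ^ 2 ≤ b} :=
  measurableSet_le (by fun_prop) (by fun_prop)

/-- A planar annulus has the area of the disk whose squared radius is the difference of the
squared radii. -/
lemma volume_annulus {a : ℝ} (ha : 0 ≤ a) (b : ℝ) :
    volume {u : Fin 2 → ℝ | a < u 0 ^ 2 + u 1 ^ 2 ∧ u 0 ^ 2 + u 1 ^ 2 ≤ b} =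
      volume {u : Fin 2 → ℝ | u 0 ^ 2 + u 1 ^ 2 ≤ b - a} := by
  rw [volume_disk_le]
  rcases lt_or_ge b a with hb | hb
  · have : {u : Fin 2 → ℝ | a < u 0 ^ 2 + u 1 ^ 2 ∧ u 0 ^ 2 + u 1 ^ 2 ≤ b} = ∅ := by
      ext u
      simp only [Set.mem_ofPred_eq, Set.mem_empty_iff_false, iff_false, not_and, not_le]
      intro h
      linarith
    rw [this, measure_empty, ENNReal.ofReal_of_nonpos]
    nlinarith [Real.pi_pos]
  · have : {u : Fin 2 → ℝ | a < u 0 ^ 2 + u 1 ^ 2 ∧ u 0 ^ 2 + u 1 ^ 2 ≤ b} =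
        {u : Fin 2 → ℝ | u 0 ^ 2 + u 1 ^ 2 ≤ b} \ {u : Fin 2 → ℝ | u 0 ^ 2 + u 1 ^ 2 ≤ a} := by
      ext u
      simp [and_comm]
    have hsub : {u : Fin 2 → ℝ | u 0 ^ 2 + u 1 ^ 2 ≤ a} ⊆
        {u : Fin 2 → ℝ | u 0 ^ 2 + u 1 ^ 2 ≤ b} :=
      Set.ofPred_subset_ofPred.2 fun _ hu => hu.trans hb
    rw [this, measure_sdiff hsub
      (measurableSet_disk_le a).nullMeasurableSet (by rw [volume_disk_le]; simp),
      volume_disk_le, volume_disk_le, ← ENNReal.ofReal_sub _ (by positivity), mul_sub]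

lemma exists_measurePreserving_split {m : ℕ} {c₁ c₂ : Fin (m + 2) → ℝ}
    (hc₁ : ∑ i, (c₁ i) ^ 2 = 1) (hc₂ : ∑ i, (c₂ i) ^ 2 = 1) (hortho : c₁ ⬝ᵥ c₂ = 0) :
    ∃ Φ : (Fin (m + 2) → ℝ) → (Fin 2 → ℝ) × (Fin m → ℝ),
      MeasurePreserving Φ volume (volume.prod volume) ∧
      ∀ x, (Φ x).1 0 = c₁ ⬝ᵥ x ∧ (Φ x).1 1 = c₂ ⬝ᵥ x ∧
        (Φ x).1 0 ^ 2 + (Φ x).1 1 ^ 2 + ∑ j, (Φ x).2 j ^ 2 = ∑ i, x i ^ 2 := by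
  let v : Fin 2 ⊕ Fin m → EuclideanSpace ℝ (Fin (m + 2)) :=
    Sum.elim ![WithLp.toLp 2 c₁, WithLp.toLp 2 c₂] 0
  have hv : Orthonormal ℝ ((Set.range (Sum.inl : Fin 2 → Fin 2 ⊕ Fin m)).domRestrict v) := by
    have key : Orthonormal ℝ ![(WithLp.toLp 2 c₁ : EuclideanSpace ℝ (Fin (m + 2))),
        WithLp.toLp 2 c₂] := by
      rw [orthonormal_iff_ite]
      have h21 : c₂ ⬝ᵥ c₁ = 0 := by rw [dotProduct_comm, hortho]
      have h11 : c₁ ⬝ᵥ c₁ = 1 := by rw [← hc₁]; simp [dotProduct, sq]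
      have h22 : c₂ ⬝ᵥ c₂ = 1 := by rw [← hc₂]; simp [dotProduct, sq]
      intro i j
      fin_cases i <;> fin_cases j <;>
        simp [EuclideanSpace.inner_eq_star_dotProduct, hortho, h21, h11, h22,
          -inner_self_eq_norm_sq_to_K]
    rw [orthonormal_iff_ite] at key ⊢
    rintro ⟨_, i, rfl⟩ ⟨_, j, rfl⟩
    simpa [v, Subtype.ext_iff] using key i j
  obtain ⟨b, hb⟩ := hv.exists_orthonormalBasis_extension_of_card_eq (by simp [add_comm])
  have hb1 : b (Sum.inl 0) = WithLp.toLp 2 c₁ := hb _ ⟨0, rfl⟩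
  have hb2 : b (Sum.inl 1) = WithLp.toLp 2 c₂ := hb _ ⟨1, rfl⟩
  refine ⟨fun x => MeasurableEquiv.sumPiEquivProdPi (fun _ => ℝ)
      (WithLp.ofLp (b.repr (WithLp.toLp 2 x))), ?_, fun x => ⟨?_, ?_, ?_⟩⟩
  · exact (volume_measurePreserving_sumPiEquivProdPi (fun _ : Fin 2 ⊕ Fin m => ℝ)).comp
      ((PiLp.volume_preserving_ofLp _).comp
        (b.measurePreserving_repr.comp (PiLp.volume_preserving_toLp _)))
  · change b.repr (WithLp.toLp 2 x) (Sum.inl 0) = _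
    rw [b.repr_apply_apply, hb1, EuclideanSpace.inner_eq_star_dotProduct]
    simp [dotProduct_comm]
  · change b.repr (WithLp.toLp 2 x) (Sum.inl 1) = _
    rw [b.repr_apply_apply, hb2, EuclideanSpace.inner_eq_star_dotProduct]
    simp [dotProduct_comm]
  · have h := b.repr.norm_map (WithLp.toLp 2 x)
    rw [← sq_eq_sq₀ (norm_nonneg _) (norm_nonneg _), EuclideanSpace.real_norm_sq_eq,
      EuclideanSpace.real_norm_sq_eq, Fintype.sum_sum_type, Fin.sum_univ_two] at h
    exact h

lemma measurableSet_sum_sq_le (n : ℕ) (b : ℝ) :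
    MeasurableSet {x : Fin n → ℝ | ∑ i, (x i) ^ 2 ≤ b} :=
  measurableSet_le (by fun_prop) (by fun_prop)

lemma volume_sum_sq_le (n : ℕ) {s : ℝ} (hs : 0 < s) :
    volume {x : Fin n → ℝ | ∑ i, (x i) ^ 2 ≤ s ^ 2} =
      ENNReal.ofReal (s ^ n) * volume {x : Fin n → ℝ | ∑ i, (x i) ^ 2 ≤ 1} := by
  have h := Measure.addHaar_preimage_smul (volume : Measure (Fin n → ℝ)) (inv_ne_zero hs.ne')
    {x : Fin n → ℝ | ∑ i, (x i) ^ 2 ≤ 1}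
  rw [Module.finrank_fin_fun, inv_pow, inv_inv, abs_of_pos (by positivity)] at h
  rw [← h]
  congr 1
  ext x
  simp only [Set.mem_ofPred_eq, Set.mem_preimage, Pi.smul_apply, smul_eq_mul, mul_pow,
    ← Finset.mul_sum, inv_pow]
  rw [inv_mul_le_iff₀ (by positivity), mul_one]

lemma volume_ball_sdiff_cylinder {n : ℕ} (hn : 2 ≤ n) {r s : ℝ} (hs : 0 < s)
    (hrs : r ^ 2 + s ^ 2 = 1) {c₁ c₂ : Fin n → ℝ}
    (hc₁ : ∑ i, (c₁ i) ^ 2 = 1) (hc₂ : ∑ i, (c₂ i) ^ 2 = 1) (hortho : c₁ ⬝ᵥ c₂ = 0) :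
    volume {x : Fin n → ℝ | r ^ 2 < (c₁ ⬝ᵥ x) ^ 2 + (c₂ ⬝ᵥ x) ^ 2 ∧ ∑ i, (x i) ^ 2 ≤ 1} =
      ENNReal.ofReal (s ^ n) * volume {x : Fin n → ℝ | ∑ i, (x i) ^ 2 ≤ 1} := by
  obtain ⟨m, rfl⟩ := Nat.exists_eq_add_of_le' hn
  obtain ⟨Φ, hΦ, h⟩ := exists_measurePreserving_split hc₁ hc₂ hortho
  rw [← volume_sum_sq_le _ hs]
  let A : Set ((Fin 2 → ℝ) × (Fin m → ℝ)) :=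
    {z | r ^ 2 < z.1 0 ^ 2 + z.1 1 ^ 2 ∧ z.1 0 ^ 2 + z.1 1 ^ 2 ≤ 1 - ∑ j, z.2 j ^ 2}
  let B : Set ((Fin 2 → ℝ) × (Fin m → ℝ)) :=
    {z | z.1 0 ^ 2 + z.1 1 ^ 2 ≤ (1 - ∑ j, z.2 j ^ 2) - r ^ 2}
  have hA₁ : MeasurableSet {z : (Fin 2 → ℝ) × (Fin m → ℝ) | r ^ 2 < z.1 0 ^ 2 + z.1 1 ^ 2} :=
    measurableSet_lt (by fun_prop) (by fun_prop)
  have hA₂ : MeasurableSet {z : (Fin 2 → ℝ) × (Fin m → ℝ) |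
      z.1 0 ^ 2 + z.1 1 ^ 2 ≤ 1 - ∑ j, z.2 j ^ 2} :=
    measurableSet_le (by fun_prop) (by fun_prop)
  have hA : MeasurableSet A := hA₁.inter hA₂
  have hB : MeasurableSet B := measurableSet_le (by fun_prop) (by fun_prop)
  have hAB : (volume.prod volume) A = (volume.prod volume) B := by
    rw [Measure.prod_apply_symm hA, Measure.prod_apply_symm hB]
    exact lintegral_congr fun y => volume_annulus (sq_nonneg r) (1 - ∑ j, y j ^ 2)
  convert hAB using 1
  · rw [← hΦ.measure_preimage hA.nullMeasurableSet]
    congr 1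
    ext x
    obtain ⟨h1, h2, h3⟩ := h x
    simp only [Set.mem_ofPred_eq, Set.mem_preimage, A, ← h1, ← h2, ← h3, le_sub_iff_add_le]
  · rw [← hΦ.measure_preimage hB.nullMeasurableSet]
    congr 1
    ext x
    obtain ⟨h1, h2, h3⟩ := h x
    simp only [Set.mem_ofPred_eq, Set.mem_preimage, B, ← h3]
    constructor <;> intro _ <;> linarith

lemma volume_unit_ball_ne_zero (n : ℕ) : volume {x : Fin n → ℝ | ∑ i, (x i) ^ 2 ≤ 1} ≠ 0 := by
  have ho : IsOpen {x : Fin n → ℝ | ∑ i, (x i) ^ 2 < 1} :=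
    isOpen_lt (by fun_prop) (by fun_prop)
  have h := ho.measure_pos volume ⟨0, by simp⟩
  exact (h.trans_le (measure_mono (Set.ofPred_subset_ofPred.2 fun _ hx => hx.le))).ne'

lemma volume_unit_ball_ne_top (n : ℕ) : volume {x : Fin n → ℝ | ∑ i, (x i) ^ 2 ≤ 1} ≠ ⊤ := by
  refine ((measure_mono ?_).trans_lt
    (measure_closedBall_lt_top (x := (0 : Fin n → ℝ)) (r := 1))).ne
  intro x hx
  rw [mem_closedBall_zero_iff, pi_norm_le_iff_of_nonneg zero_le_one]
  intro i
  rw [Real.norm_eq_abs, ← sq_le_one_iff_abs_le_one]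
  exact (Finset.single_le_sum (f := fun i => x i ^ 2) (fun j _ => sq_nonneg _)
    (Finset.mem_univ i)).trans hx

instance isProbabilityMeasure_unifBall_s9 (n : ℕ) : IsProbabilityMeasure (unifBall n) :=
  ⟨by
    rw [unifBall, Measure.smul_apply, Measure.restrict_apply_univ, smul_eq_mul]
    exact ENNReal.inv_mul_cancel (volume_unit_ball_ne_zero n) (volume_unit_ball_ne_top n)⟩

lemma measurableSet_projection_le {n : ℕ} (c₁ c₂ : Fin n → ℝ) (r : ℝ) :
    MeasurableSet {x : Fin n → ℝ | Real.sqrt ((c₁ ⬝ᵥ x) ^ 2 + (c₂ ⬝ᵥ x) ^ 2) ≤ r} := by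
  simp only [dotProduct]
  exact measurableSet_le (by fun_prop) (by fun_prop)

lemma unifBall_projection_le {n : ℕ} (hn : 2 ≤ n) {r s : ℝ} (hr : 0 ≤ r) (hs : 0 < s)
    (hrs : r ^ 2 + s ^ 2 = 1) {c₁ c₂ : Fin n → ℝ}
    (hc₁ : ∑ i, (c₁ i) ^ 2 = 1) (hc₂ : ∑ i, (c₂ i) ^ 2 = 1) (hortho : c₁ ⬝ᵥ c₂ = 0) :
    unifBall n {x : Fin n → ℝ | Real.sqrt ((c₁ ⬝ᵥ x) ^ 2 + (c₂ ⬝ᵥ x) ^ 2) ≤ r} =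
      ENNReal.ofReal (1 - s ^ n) := by
  have hM := measurableSet_projection_le c₁ c₂ r
  have hcompl : unifBall n {x : Fin n → ℝ | Real.sqrt ((c₁ ⬝ᵥ x) ^ 2 + (c₂ ⬝ᵥ x) ^ 2) ≤ r}ᶜ =
      ENNReal.ofReal (s ^ n) := by
    have hset : {x : Fin n → ℝ | Real.sqrt ((c₁ ⬝ᵥ x) ^ 2 + (c₂ ⬝ᵥ x) ^ 2) ≤ r}ᶜ ∩
        {x : Fin n → ℝ | ∑ i, (x i) ^ 2 ≤ 1} =
        {x : Fin n → ℝ | r ^ 2 < (c₁ ⬝ᵥ x) ^ 2 + (c₂ ⬝ᵥ x) ^ 2 ∧ ∑ i, (x i) ^ 2 ≤ 1} := by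
      ext x
      simp [Real.lt_sqrt hr]
    rw [unifBall, Measure.smul_apply, Measure.restrict_apply hM.compl, hset,
      volume_ball_sdiff_cylinder hn hs hrs hc₁ hc₂ hortho, smul_eq_mul, mul_left_comm,
      ENNReal.inv_mul_cancel (volume_unit_ball_ne_zero n) (volume_unit_ball_ne_top n), mul_one]
  rw [← compl_compl {x : Fin n → ℝ | Real.sqrt ((c₁ ⬝ᵥ x) ^ 2 + (c₂ ⬝ᵥ x) ^ 2) ≤ r},
    prob_compl_eq_one_sub hM.compl, hcompl, ENNReal.ofReal_sub _ (by positivity),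
    ENNReal.ofReal_one]

lemma pi_unifBall_lt_iSup {n : ℕ} (hn : 2 ≤ n) {r s : ℝ} (hr : 0 ≤ r) (hs : 0 < s)
    (hrs : r ^ 2 + s ^ 2 = 1) {c₁ c₂ : Fin n → ℝ}
    (hc₁ : ∑ i, (c₁ i) ^ 2 = 1) (hc₂ : ∑ i, (c₂ i) ^ 2 = 1) (hortho : c₁ ⬝ᵥ c₂ = 0) (N : ℕ) :
    Measure.pi (fun _ : Fin N => unifBall n)
      {ξ : Fin N → Fin n → ℝ |
        r < ⨆ i : Fin N, Real.sqrt ((c₁ ⬝ᵥ ξ i) ^ 2 + (c₂ ⬝ᵥ ξ i) ^ 2)} =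
      ENNReal.ofReal (1 - (1 - s ^ n) ^ N) := by
  have hs1 : s ^ n ≤ 1 := pow_le_one₀ hs.le (by nlinarith [sq_nonneg r])
  have hset : {ξ : Fin N → Fin n → ℝ |
        r < ⨆ i : Fin N, Real.sqrt ((c₁ ⬝ᵥ ξ i) ^ 2 + (c₂ ⬝ᵥ ξ i) ^ 2)} =
      (Set.univ.pi fun _ : Fin N =>
        {x : Fin n → ℝ | Real.sqrt ((c₁ ⬝ᵥ x) ^ 2 + (c₂ ⬝ᵥ x) ^ 2) ≤ r})ᶜ := by
    ext ξ
    simp only [Set.mem_ofPred_eq, Set.mem_compl_iff, Set.mem_univ_pi]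
    rw [← not_le, not_iff_not]
    exact ⟨fun h i => (le_ciSup (Set.finite_range _).bddAbove i).trans h,
      fun h => Real.iSup_le h hr⟩
  rw [hset, prob_compl_eq_one_sub
    (MeasurableSet.univ_pi fun _ => measurableSet_projection_le c₁ c₂ r), Measure.pi_pi,
    unifBall_projection_le hn hr hs hrs hc₁ hc₂ hortho, Finset.prod_const, Finset.card_univ,
    Fintype.card_fin, ← ENNReal.ofReal_pow (by linarith), ← ENNReal.ofReal_one,
    ENNReal.ofReal_sub _ (pow_nonneg (by linarith) _)]

lemma le_one_sub_pow_iff {p a : ℝ} (hp : p < 1) (ha : 0 < a) (ha1 : a < 1) (N : ℕ) :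
    p ≤ 1 - a ^ N ↔ Real.log (1 - p) / Real.log a ≤ N := by
  rw [div_le_iff_of_neg (Real.log_neg ha ha1), ← Real.log_pow,
    Real.log_le_log_iff (by positivity) (by linarith)]
  constructor <;> intro _ <;> linarith

/-- Theorem 2 (ball, multiobjective): for orthonormal `c₁, c₂ ∈ ℝⁿ`, `N` i.i.d. samples
uniform on the unit Euclidean ball, and `κ = maxᵢ ‖(c₁ᵀξ⁽ⁱ⁾, c₂ᵀξ⁽ⁱ⁾)‖₂`, one has
`P{κ > 1-δ} ≥ p` iff `N ≥ ln(1-p)/ln(1-(2δ-δ²)^(n/2))`; in particular the minimal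
such sample size is the ceiling of that ratio. -/
theorem stmt_9 (n : ℕ) (hn : 2 ≤ n) (p δ : ℝ)
    (hp : p ∈ Set.Ioo (0 : ℝ) 1) (hδ : δ ∈ Set.Ioo (0 : ℝ) 1)
    (c₁ c₂ : Fin n → ℝ)
    (hc₁ : ∑ i, (c₁ i) ^ 2 = 1) (hc₂ : ∑ i, (c₂ i) ^ 2 = 1)
    (hortho : c₁ ⬝ᵥ c₂ = 0) :
    (∀ N : ℕ,
      ENNReal.ofReal p ≤
          Measure.pi (fun _ : Fin N => unifBall n)
            {ξ : Fin N → Fin n → ℝ |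
              1 - δ < ⨆ i : Fin N, Real.sqrt ((c₁ ⬝ᵥ ξ i) ^ 2 + (c₂ ⬝ᵥ ξ i) ^ 2)} ↔
        Real.log (1 - p) / Real.log (1 - (2 * δ - δ ^ 2) ^ ((n : ℝ) / 2)) ≤ (N : ℝ)) ∧
    IsLeast
      {N : ℕ |
        ENNReal.ofReal p ≤
          Measure.pi (fun _ : Fin N => unifBall n)
            {ξ : Fin N → Fin n → ℝ |
              1 - δ < ⨆ i : Fin N, Real.sqrt ((c₁ ⬝ᵥ ξ i) ^ 2 + (c₂ ⬝ᵥ ξ i) ^ 2)}}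
      ⌈Real.log (1 - p) / Real.log (1 - (2 * δ - δ ^ 2) ^ ((n : ℝ) / 2))⌉₊ := by
  obtain ⟨hp0, hp1⟩ := hp
  obtain ⟨hδ0, hδ1⟩ := hδ
  have hpos : 0 < 2 * δ - δ ^ 2 := by nlinarith
  have hlt : 2 * δ - δ ^ 2 < 1 := by nlinarith
  set s := Real.sqrt (2 * δ - δ ^ 2) with hs_def
  have hs : 0 < s := Real.sqrt_pos.2 hpos
  have hsq : s ^ 2 = 2 * δ - δ ^ 2 := Real.sq_sqrt hpos.le
  have hs1 : s < 1 := by nlinarith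
  have hsn : (2 * δ - δ ^ 2) ^ ((n : ℝ) / 2) = s ^ n := by
    rw [hs_def, Real.sqrt_eq_rpow, ← Real.rpow_mul_natCast hpos.le]
    congr 1
    ring
  have hsn1 : s ^ n < 1 := pow_lt_one₀ hs.le hs1 (by omega)
  have hsn0 : 0 < s ^ n := by positivity
  have hiff : ∀ N : ℕ,
      ENNReal.ofReal p ≤
          Measure.pi (fun _ : Fin N => unifBall n)
            {ξ : Fin N → Fin n → ℝ |
              1 - δ < ⨆ i : Fin N, Real.sqrt ((c₁ ⬝ᵥ ξ i) ^ 2 + (c₂ ⬝ᵥ ξ i) ^ 2)} ↔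
        Real.log (1 - p) / Real.log (1 - (2 * δ - δ ^ 2) ^ ((n : ℝ) / 2)) ≤ (N : ℝ) := by
    intro N
    rw [pi_unifBall_lt_iSup hn (by linarith) hs (by rw [hsq]; ring) hc₁ hc₂ hortho N, hsn,
      ENNReal.ofReal_le_ofReal_iff (sub_nonneg.2 (pow_le_one₀ (by linarith) (by linarith))),
      le_one_sub_pow_iff hp1 (by linarith) (by linarith)]
  exact ⟨hiff, (hiff _).2 (Nat.le_ceil _), fun N hN => Nat.ceil_le.2 ((hiff N).1 hN)⟩
end
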